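/- (Chang's type Lemma) Let γ₁, γ₂ ∈ L^∞_loc(ℝ) and define φ : ℝ² → ℝ by φ(t,s) = ∫₀ᵗ γ₁(ξ)dξ + ∫₀ˢ γ₂(ξ)dξ. If in addition the one-sided limits γ₁(r+0), γ₁(r−0) and γ₂(r+0), γ₂(r−0) exist for every r ∈ ℝ, then for every (t,s) ∈ ℝ² the Clarke subdifferential satisfies the equality ∂φ(t,s) = γ̂₁(t) × γ̂₂(s), where γ̂ₖ(r) = [γ̲ₖ(r), γ̄ₖ(r)] and, under the assumption, γ̲ₖ(r) = min{γₖ(r+0), γₖ(r−0)} and γ̄ₖ(r) = max{γₖ(r+0), γₖ(r−0)}, for k = 1, 2. -/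

import Mathlib

open MeasureTheory Filter

/-- `γ̄_μ(t) = ess sup_{|s−t|<μ} γ(s)`. -/
noncomputable def essSupNear (γ : ℝ → ℝ) (t μ : ℝ) : ℝ :=
  essSup γ (volume.restrict (Set.Ioo (t - μ) (t + μ)))

/-- `γ̲_μ(t) = ess inf_{|s−t|<μ} γ(s)`. -/
noncomputable def essInfNear (γ : ℝ → ℝ) (t μ : ℝ) : ℝ :=
  essInf γ (volume.restrict (Set.Ioo (t - μ) (t + μ)))

/-- `γ̄(t) = lim_{μ ↓ 0} γ̄_μ(t)` (equal, by monotonicity, to the infimum over `μ > 0`). -/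
noncomputable def gammaUpper (γ : ℝ → ℝ) (t : ℝ) : ℝ :=
  ⨅ μ : Set.Ioi (0 : ℝ), essSupNear γ t μ

/-- `γ̲(t) = lim_{μ ↓ 0} γ̲_μ(t)` (equal, by antitonicity, to the supremum over `μ > 0`). -/
noncomputable def gammaLower (γ : ℝ → ℝ) (t : ℝ) : ℝ :=
  ⨆ μ : Set.Ioi (0 : ℝ), essInfNear γ t μ

/-- The Clarke generalized directional derivative of `ψ` at `x` in direction `v`. -/
noncomputable def clarkeDeriv {E : Type*} [NormedAddCommGroup E] [NormedSpace ℝ E]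
    (ψ : E → ℝ) (x v : E) : ℝ :=
  Filter.limsup (fun p : E × ℝ => (ψ (p.1 + p.2 • v) - ψ p.1) / p.2)
    ((nhds x) ×ˢ (nhdsWithin 0 (Set.Ioi (0 : ℝ))))

/-- The Clarke subdifferential `∂ψ(x) = {ξ ∈ E* : ⟨ξ,v⟩ ≤ ψ°(x;v) for all v ∈ E}`. -/
def clarkeSubdiff {E : Type*} [NormedAddCommGroup E] [NormedSpace ℝ E]
    (ψ : E → ℝ) (x : E) : Set (E →L[ℝ] ℝ) :=
  {ξ | ∀ v : E, ξ v ≤ clarkeDeriv ψ x v}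

/-- `γ(t+0)` exists and equals `L`: for every `ε > 0` there is `δ > 0` with
`|γ(s) − L| < ε` for a.e. `s ∈ (t, t+δ)`. -/
def hasRightLimAe (γ : ℝ → ℝ) (t L : ℝ) : Prop :=
  ∀ ε : ℝ, 0 < ε → ∃ δ : ℝ, 0 < δ ∧
    ∀ᵐ s ∂(volume.restrict (Set.Ioo t (t + δ))), |γ s - L| < ε

/-- `γ(t−0)` exists and equals `L`. -/
def hasLeftLimAe (γ : ℝ → ℝ) (t L : ℝ) : Prop :=
  ∀ ε : ℝ, 0 < ε → ∃ δ : ℝ, 0 < δ ∧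
    ∀ᵐ s ∂(volume.restrict (Set.Ioo (t - δ) t)), |γ s - L| < ε

open Set Topology

section OneSidedLimits

variable {γ : ℝ → ℝ}

/-- A measurable function that is essentially bounded on bounded intervals is locally integrable. -/
lemma intervalIntegrable_of_locally_ae_bounded (hm : Measurable γ)
    (hloc : ∀ R : ℝ, 0 < R → ∃ C : ℝ, ∀ᵐ s ∂(volume.restrict (Icc (-R) R)), |γ s| ≤ C)
    (a b : ℝ) : IntervalIntegrable γ volume a b := by
  set R := |a| + |b| + 1 with hR
  have hR0 : 0 < R := by positivity
  obtain ⟨C, hC⟩ := hloc R hR0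
  have hint : IntegrableOn γ (Icc (-R) R) volume := by
    refine Measure.integrableOn_of_bounded (M := C) (by simp) hm.aestronglyMeasurable ?_
    simpa [Real.norm_eq_abs] using hC
  rw [intervalIntegrable_iff]
  refine hint.mono_set (uIoc_subset_uIcc.trans ?_)
  refine uIcc_subset_Icc ⟨?_, ?_⟩ ⟨?_, ?_⟩ <;>
    linarith [neg_abs_le a, neg_abs_le b, le_abs_self a, le_abs_self b, abs_nonneg a, abs_nonneg b]

/-- Mean value property of the primitive of an essentially bounded function. -/
lemma exists_integral_sub_eq_mul (hi : ∀ a b, IntervalIntegrable γ volume a b) {l u A B : ℝ}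
    (hBA : B ≤ A) (h : ∀ᵐ x ∂(volume.restrict (Ioo l u)), B ≤ γ x ∧ γ x ≤ A)
    {x y : ℝ} (hx : x ∈ Icc l u) (hy : y ∈ Icc l u) :
    ∃ c ∈ Icc B A, (∫ ξ in (0:ℝ)..y, γ ξ) - ∫ ξ in (0:ℝ)..x, γ ξ = (y - x) * c := by
  wlog hxy : x ≤ y generalizing x y
  · obtain ⟨c, hc, hcc⟩ := this hy hx (le_of_not_ge hxy)
    exact ⟨c, hc, by linarith⟩
  rcases hxy.eq_or_lt with rfl | hlt
  · exact ⟨B, ⟨le_rfl, hBA⟩, by simp⟩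
  have h' : ∀ᵐ z ∂(volume.restrict (Icc x y)), B ≤ γ z ∧ γ z ≤ A := by
    rw [← restrict_Ioo_eq_restrict_Icc]
    exact ae_mono (Measure.restrict_mono (Ioo_subset_Ioo hx.1 hy.2) le_rfl) h
  have hlo := intervalIntegral.integral_mono_ae_restrict hxy (f := fun _ => B)
    intervalIntegrable_const (hi x y) (h'.mono fun _ hz => hz.1)
  have hup := intervalIntegral.integral_mono_ae_restrict hxy (g := fun _ => A)
    (hi x y) intervalIntegrable_const (h'.mono fun _ hz => hz.2)
  rw [intervalIntegral.integral_const, smul_eq_mul] at hlo hup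
  have hpos : 0 < y - x := sub_pos.2 hlt
  rw [intervalIntegral.integral_interval_sub_left (hi 0 y) (hi 0 x)]
  refine ⟨(∫ ξ in x..y, γ ξ) / (y - x), ⟨?_, ?_⟩, ?_⟩
  · rw [le_div_iff₀ hpos]; linarith
  · rw [div_le_iff₀ hpos]; linarith
  · field_simp

lemma ae_bounds_of_hasRightLimAe_of_hasLeftLimAe {t p m : ℝ} (hp : hasRightLimAe γ t p)
    (hm : hasLeftLimAe γ t m) {ε : ℝ} (hε : 0 < ε) :
    ∃ δ : ℝ, 0 < δ ∧ ∀ᵐ x ∂(volume.restrict (Ioo (t - δ) (t + δ))),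
      min p m - ε ≤ γ x ∧ γ x ≤ max p m + ε := by
  obtain ⟨δ₁, hδ₁, h₁⟩ := hp ε hε
  obtain ⟨δ₂, hδ₂, h₂⟩ := hm ε hε
  refine ⟨min δ₁ δ₂, lt_min hδ₁ hδ₂, ?_⟩
  rw [ae_restrict_iff' measurableSet_Ioo] at h₁ h₂ ⊢
  have hne : ∀ᵐ x ∂(volume : Measure ℝ), x ≠ t := by simp [ae_iff]
  filter_upwards [h₁, h₂, hne] with x hx₁ hx₂ hxt hx
  rcases lt_or_gt_of_ne hxt with hlt | hgt
  · have := abs_lt.1 (hx₂ ⟨by linarith [hx.1, min_le_right δ₁ δ₂], hlt⟩)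
    constructor <;> linarith [min_le_right p m, le_max_right p m]
  · have := abs_lt.1 (hx₁ ⟨hgt, by linarith [hx.2, min_le_left δ₁ δ₂]⟩)
    constructor <;> linarith [min_le_left p m, le_max_left p m]

lemma frequently_ae_of_ae_of_subset {s u : Set ℝ} {P : ℝ → Prop} (hsu : s ⊆ u)
    (hs : volume s ≠ 0) (h : ∀ᵐ x ∂(volume.restrict s), P x) :
    ∃ᶠ x in ae (volume.restrict u), P x := by
  have : NeBot (ae (volume.restrict s)) := by
    rwa [ae_neBot, Ne, Measure.restrict_eq_zero]
  exact h.frequently.filter_mono (ae_mono (Measure.restrict_mono hsu le_rfl))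

lemma frequently_near_right_lim {t p : ℝ} (hp : hasRightLimAe γ t p) {ε μ : ℝ} (hε : 0 < ε)
    (hμ : 0 < μ) : ∃ᶠ x in ae (volume.restrict (Ioo (t - μ) (t + μ))), |γ x - p| < ε := by
  obtain ⟨δ, hδ, h⟩ := hp ε hε
  have hmin := lt_min hδ hμ
  refine frequently_ae_of_ae_of_subset (s := Ioo t (t + min δ μ)) ?_ ?_
    (ae_mono (Measure.restrict_mono ?_ le_rfl) h)
  · exact Ioo_subset_Ioo (by linarith) (by linarith [min_le_right δ μ])
  · simpa using hmin
  · exact Ioo_subset_Ioo le_rfl (by linarith [min_le_left δ μ])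

lemma frequently_near_left_lim {t m : ℝ} (hm : hasLeftLimAe γ t m) {ε μ : ℝ} (hε : 0 < ε)
    (hμ : 0 < μ) : ∃ᶠ x in ae (volume.restrict (Ioo (t - μ) (t + μ))), |γ x - m| < ε := by
  obtain ⟨δ, hδ, h⟩ := hm ε hε
  have hmin := lt_min hδ hμ
  refine frequently_ae_of_ae_of_subset (s := Ioo (t - min δ μ) t) ?_ ?_
    (ae_mono (Measure.restrict_mono ?_ le_rfl) h)
  · exact Ioo_subset_Ioo (by linarith [min_le_right δ μ]) (by linarith)
  · simpa using hmin
  · exact Ioo_subset_Ioo (by linarith [min_le_left δ μ]) le_rfl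

lemma neBot_ae_restrict_Ioo {t μ : ℝ} (hμ : 0 < μ) :
    NeBot (ae (volume.restrict (Ioo (t - μ) (t + μ)))) := by
  rw [ae_neBot, Ne, Measure.restrict_eq_zero]
  simp only [Real.volume_Ioo, ENNReal.ofReal_eq_zero, not_le]
  linarith

lemma ae_abs_le_restrict_Ioo
    (hloc : ∀ R : ℝ, 0 < R → ∃ C : ℝ, ∀ᵐ s ∂(volume.restrict (Icc (-R) R)), |γ s| ≤ C)
    (t : ℝ) {μ : ℝ} (hμ : 0 < μ) :
    ∃ C : ℝ, ∀ᵐ x ∂(volume.restrict (Ioo (t - μ) (t + μ))), |γ x| ≤ C := by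
  obtain ⟨C, hC⟩ := hloc (|t| + μ) (by positivity)
  refine ⟨C, ae_mono (Measure.restrict_mono (fun x hx => ?_) le_rfl) hC⟩
  exact ⟨by linarith [hx.1, neg_abs_le t], by linarith [hx.2, le_abs_self t]⟩

lemma gammaUpper_eq_max
    (hloc : ∀ R : ℝ, 0 < R → ∃ C : ℝ, ∀ᵐ s ∂(volume.restrict (Icc (-R) R)), |γ s| ≤ C)
    {t p m : ℝ} (hp : hasRightLimAe γ t p) (hm : hasLeftLimAe γ t m) :
    gammaUpper γ t = max p m := by
  have hlow : ∀ μ : Ioi (0 : ℝ), max p m ≤ essSupNear γ t μ := by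
    rintro ⟨μ, hμ : 0 < μ⟩
    obtain ⟨C, hC⟩ := ae_abs_le_restrict_Ioo hloc t hμ
    have hbdd : IsBoundedUnder (· ≤ ·) (ae (volume.restrict (Ioo (t - μ) (t + μ)))) γ :=
      ⟨C, eventually_map.2 (hC.mono fun _ hx => (abs_le.1 hx).2)⟩
    refine max_le ?_ ?_ <;> refine le_of_forall_pos_sub_le fun ε hε => ?_
    · exact le_limsup_of_frequently_le ((frequently_near_right_lim hp hε hμ).mono
        fun x hx => by linarith [(abs_lt.1 hx).1]) hbdd
    · exact le_limsup_of_frequently_le ((frequently_near_left_lim hm hε hμ).mono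
        fun x hx => by linarith [(abs_lt.1 hx).1]) hbdd
  have : Nonempty (Ioi (0 : ℝ)) := ⟨⟨1, mem_Ioi.2 one_pos⟩⟩
  refine le_antisymm (le_of_forall_pos_le_add fun ε hε => ?_) (le_ciInf hlow)
  obtain ⟨δ, hδ, h⟩ := ae_bounds_of_hasRightLimAe_of_hasLeftLimAe hp hm hε
  have := neBot_ae_restrict_Ioo (t := t) hδ
  refine (ciInf_le ⟨max p m, forall_mem_range.2 hlow⟩ (⟨δ, hδ⟩ : Ioi (0 : ℝ))).trans ?_
  refine limsup_le_of_le ?_ (h.mono fun _ hx => hx.2)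
  exact IsBoundedUnder.isCoboundedUnder_le
    ⟨min p m - ε, eventually_map.2 (h.mono fun _ hx => hx.1)⟩

lemma gammaLower_eq_min
    (hloc : ∀ R : ℝ, 0 < R → ∃ C : ℝ, ∀ᵐ s ∂(volume.restrict (Icc (-R) R)), |γ s| ≤ C)
    {t p m : ℝ} (hp : hasRightLimAe γ t p) (hm : hasLeftLimAe γ t m) :
    gammaLower γ t = min p m := by
  have hupp : ∀ μ : Ioi (0 : ℝ), essInfNear γ t μ ≤ min p m := by
    rintro ⟨μ, hμ : 0 < μ⟩
    obtain ⟨C, hC⟩ := ae_abs_le_restrict_Ioo hloc t hμ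
    have hbdd : IsBoundedUnder (· ≥ ·) (ae (volume.restrict (Ioo (t - μ) (t + μ)))) γ :=
      ⟨-C, eventually_map.2 (hC.mono fun _ hx => (abs_le.1 hx).1)⟩
    refine le_min ?_ ?_ <;> refine le_of_forall_pos_le_add fun ε hε => ?_
    · exact liminf_le_of_frequently_le ((frequently_near_right_lim hp hε hμ).mono
        fun x hx => by linarith [(abs_lt.1 hx).2]) hbdd
    · exact liminf_le_of_frequently_le ((frequently_near_left_lim hm hε hμ).mono
        fun x hx => by linarith [(abs_lt.1 hx).2]) hbdd
  have : Nonempty (Ioi (0 : ℝ)) := ⟨⟨1, mem_Ioi.2 one_pos⟩⟩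
  refine le_antisymm (ciSup_le hupp) (le_of_forall_pos_sub_le fun ε hε => ?_)
  obtain ⟨δ, hδ, h⟩ := ae_bounds_of_hasRightLimAe_of_hasLeftLimAe hp hm hε
  have := neBot_ae_restrict_Ioo (t := t) hδ
  refine le_trans ?_ (le_ciSup ⟨min p m, forall_mem_range.2 hupp⟩ (⟨δ, hδ⟩ : Ioi (0 : ℝ)))
  refine le_liminf_of_le ?_ (h.mono fun _ hx => hx.1)
  exact IsBoundedUnder.isCoboundedUnder_ge
    ⟨max p m + ε, eventually_map.2 (h.mono fun _ hx => hx.2)⟩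

lemma mul_le_max_mul_of_mem_Icc {a e p m : ℝ} (he : e ∈ Icc (min p m) (max p m)) :
    a * e ≤ max (a * p) (a * m) := by
  rcases le_total 0 a with ha | ha
  · rw [← mul_max_of_nonneg _ _ ha]
    exact mul_le_mul_of_nonneg_left he.2 ha
  · refine (mul_le_mul_of_nonpos_left he.1 ha).trans ?_
    rcases min_choice p m with h | h <;> simp [h]

lemma mul_le_max_mul_add {a c p m ε : ℝ}
    (hc : c ∈ Icc (min p m - ε) (max p m + ε)) :
    a * c ≤ max (a * p) (a * m) + |a| * ε := by
  rcases le_total 0 a with ha | ha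
  · rw [← mul_max_of_nonneg _ _ ha, abs_of_nonneg ha, ← mul_add]
    exact mul_le_mul_of_nonneg_left hc.2 ha
  · have h₁ := mul_le_mul_of_nonpos_left hc.1 ha
    have h₂ : a * min p m ≤ max (a * p) (a * m) :=
      mul_le_max_mul_of_mem_Icc ⟨le_rfl, min_le_max⟩
    rw [abs_of_nonpos ha]
    linarith

/-- The difference quotients of a primitive of `γ` are eventually close to multiples of values
between the one-sided limits. -/
lemma eventually_quotient_eq_mul (hi : ∀ a b, IntervalIntegrable γ volume a b) {t p m : ℝ}
    (hp : hasRightLimAe γ t p) (hm : hasLeftLimAe γ t m) (a : ℝ) {ε : ℝ} (hε : 0 < ε) :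
    ∀ᶠ q : ℝ × ℝ in 𝓝 t ×ˢ 𝓝[>] 0, ∃ c ∈ Icc (min p m - ε) (max p m + ε),
      ((∫ ξ in (0:ℝ)..(q.1 + q.2 * a), γ ξ) - ∫ ξ in (0:ℝ)..q.1, γ ξ) / q.2 = a * c := by
  obtain ⟨δ, hδ, h⟩ := ae_bounds_of_hasRightLimAe_of_hasLeftLimAe hp hm hε
  have hnhds : Icc (t - δ) (t + δ) ∈ 𝓝 t := Icc_mem_nhds (by linarith) (by linarith)
  have h₁ : Tendsto (fun q : ℝ × ℝ => q.1) (𝓝 t ×ˢ 𝓝[>] 0) (𝓝 t) := tendsto_fst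
  have h₂ : Tendsto (fun q : ℝ × ℝ => q.2) (𝓝 t ×ˢ 𝓝[>] 0) (𝓝 0) :=
    tendsto_snd.mono_right nhdsWithin_le_nhds
  have h₃ : Tendsto (fun q : ℝ × ℝ => q.1 + q.2 * a) (𝓝 t ×ˢ 𝓝[>] 0) (𝓝 t) := by
    simpa using h₁.add (h₂.mul_const a)
  have h₄ : ∀ᶠ q : ℝ × ℝ in 𝓝 t ×ˢ 𝓝[>] 0, 0 < q.2 :=
    tendsto_snd.eventually self_mem_nhdsWithin
  filter_upwards [h₁ hnhds, h₃ hnhds, h₄] with q hq₁ hq₃ hq₄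
  obtain ⟨c, hc, hcc⟩ := exists_integral_sub_eq_mul hi
    (by linarith [min_le_max (a := p) (b := m)]) h hq₁ hq₃
  refine ⟨c, hc, ?_⟩
  rw [hcc]
  field_simp
  ring

/-- If `γ` is essentially close to `L` on intervals containing the segments between `t + r α` and
`t + r β` for small `r > 0`, the difference quotients of its primitive tend to `(β - α) * L`. -/
lemma tendsto_quotient_of_ae_near (hi : ∀ a b, IntervalIntegrable γ volume a b) {t L α β : ℝ}
    (h : ∀ ε : ℝ, 0 < ε → ∃ l u : ℝ, (∀ᵐ x ∂(volume.restrict (Ioo l u)), |γ x - L| < ε) ∧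
      ∀ᶠ r : ℝ in 𝓝[>] 0, t + r * α ∈ Icc l u ∧ t + r * β ∈ Icc l u) :
    Tendsto (fun r : ℝ => ((∫ ξ in (0:ℝ)..(t + r * β), γ ξ) - ∫ ξ in (0:ℝ)..(t + r * α), γ ξ) / r)
      (𝓝[>] 0) (𝓝 ((β - α) * L)) := by
  rw [Metric.tendsto_nhds]
  intro η hη
  have hpos : 0 < |β - α| + 1 := by positivity
  obtain ⟨l, u, hae, hr⟩ := h (η / (|β - α| + 1)) (by positivity)
  filter_upwards [hr, self_mem_nhdsWithin] with r ⟨hx, hy⟩ (hr0 : 0 < r)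
  obtain ⟨c, hc, hcc⟩ := exists_integral_sub_eq_mul hi
    (B := L - η / (|β - α| + 1)) (A := L + η / (|β - α| + 1))
    (by linarith [div_pos hη hpos])
    (hae.mono fun z hz => ⟨by linarith [(abs_lt.1 hz).1], by linarith [(abs_lt.1 hz).2]⟩) hx hy
  have hq : (t + r * β - (t + r * α)) * c / r = (β - α) * c := by
    field_simp
    ring
  have hcL : |c - L| ≤ η / (|β - α| + 1) :=
    abs_le.2 ⟨by linarith [hc.1], by linarith [hc.2]⟩
  rw [hcc, hq, Real.dist_eq, ← mul_sub, abs_mul]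
  calc |β - α| * |c - L| ≤ |β - α| * (η / (|β - α| + 1)) := by gcongr
    _ < (|β - α| + 1) * (η / (|β - α| + 1)) :=
      mul_lt_mul_of_pos_right (lt_add_one _) (by positivity)
    _ = η := mul_div_cancel₀ _ hpos.ne'

/-- The larger of the two one-sided limits, scaled by `a`, is a limit of difference quotients. -/
lemma exists_tendsto_quotient (hi : ∀ a b, IntervalIntegrable γ volume a b) {t p m : ℝ}
    (hp : hasRightLimAe γ t p) (hm : hasLeftLimAe γ t m) (a : ℝ) :
    ∃ w : ℝ → ℝ, Tendsto w (𝓝[>] 0) (𝓝 t) ∧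
      Tendsto (fun r => ((∫ ξ in (0:ℝ)..(w r + r * a), γ ξ) - ∫ ξ in (0:ℝ)..(w r), γ ξ) / r)
        (𝓝[>] 0) (𝓝 (max (a * p) (a * m))) := by
  have hlim : ∀ α : ℝ, Tendsto (fun r : ℝ => t + r * α) (𝓝[>] 0) (𝓝 t) := fun α => by
    have hid : Tendsto (fun r : ℝ => r) (𝓝[>] 0) (𝓝 0) :=
      tendsto_id.mono_right nhdsWithin_le_nhds
    simpa using (hid.mul_const α).const_add t
  have key : ∀ α L : ℝ, (∀ ε : ℝ, 0 < ε → ∃ l u : ℝ,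
      (∀ᵐ x ∂(volume.restrict (Ioo l u)), |γ x - L| < ε) ∧
        ∀ᶠ r : ℝ in 𝓝[>] 0, t + r * α ∈ Icc l u ∧ t + r * (α + a) ∈ Icc l u) →
      ∃ w : ℝ → ℝ, Tendsto w (𝓝[>] 0) (𝓝 t) ∧
        Tendsto (fun r => ((∫ ξ in (0:ℝ)..(w r + r * a), γ ξ) - ∫ ξ in (0:ℝ)..(w r), γ ξ) / r)
          (𝓝[>] 0) (𝓝 (a * L)) := fun α L h =>
    ⟨fun r => t + r * α, hlim α, by
      simpa only [mul_add, add_assoc, add_sub_cancel_left] using tendsto_quotient_of_ae_near hi h⟩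
  rcases max_choice (a * p) (a * m) with h | h <;> rw [h]
  · refine key (max (-a) 0) p fun ε hε => ?_
    obtain ⟨δ, hδ, hae⟩ := hp ε hε
    refine ⟨t, t + δ, hae, ?_⟩
    have hlt : ∀ᶠ y in 𝓝 t, y ≤ t + δ := eventually_le_nhds (by linarith)
    filter_upwards [hlim (max (-a) 0) |>.eventually hlt,
      hlim (max (-a) 0 + a) |>.eventually hlt, self_mem_nhdsWithin] with r h₁ h₂ (hr : 0 < r)
    refine ⟨⟨?_, h₁⟩, ⟨?_, h₂⟩⟩ <;> refine le_add_of_nonneg_right (mul_nonneg hr.le ?_)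
    · exact le_max_right _ _
    · linarith [le_max_left (-a) 0]
  · refine key (min (-a) 0) m fun ε hε => ?_
    obtain ⟨δ, hδ, hae⟩ := hm ε hε
    refine ⟨t - δ, t, hae, ?_⟩
    have hlt : ∀ᶠ y in 𝓝 t, t - δ ≤ y := eventually_ge_nhds (by linarith)
    filter_upwards [hlim (min (-a) 0) |>.eventually hlt,
      hlim (min (-a) 0 + a) |>.eventually hlt, self_mem_nhdsWithin] with r h₁ h₂ (hr : 0 < r)
    refine ⟨⟨h₁, ?_⟩, ⟨h₂, ?_⟩⟩ <;>
      refine add_le_of_nonpos_right (mul_nonpos_of_nonneg_of_nonpos hr.le ?_)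
    · exact min_le_right _ _
    · linarith [min_le_left (-a) 0]

end OneSidedLimits

/-- The Clarke derivative of a sum of primitives in separate variables. -/
lemma clarkeDeriv_separated_integrals {γ₁ γ₂ : ℝ → ℝ}
    (hi₁ : ∀ a b, IntervalIntegrable γ₁ volume a b)
    (hi₂ : ∀ a b, IntervalIntegrable γ₂ volume a b) {φ : ℝ × ℝ → ℝ}
    (hφ : ∀ p : ℝ × ℝ, φ p = (∫ ξ in (0:ℝ)..p.1, γ₁ ξ) + ∫ ξ in (0:ℝ)..p.2, γ₂ ξ)
    {t s p₁ m₁ p₂ m₂ : ℝ} (hp₁ : hasRightLimAe γ₁ t p₁) (hm₁ : hasLeftLimAe γ₁ t m₁)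
    (hp₂ : hasRightLimAe γ₂ s p₂) (hm₂ : hasLeftLimAe γ₂ s m₂) (a b : ℝ) :
    clarkeDeriv φ (t, s) (a, b) = max (a * p₁) (a * m₁) + max (b * p₂) (b * m₂) := by
  have hquot : ∀ q : (ℝ × ℝ) × ℝ, (φ (q.1 + q.2 • (a, b)) - φ q.1) / q.2 =
      ((∫ ξ in (0:ℝ)..(q.1.1 + q.2 * a), γ₁ ξ) - ∫ ξ in (0:ℝ)..q.1.1, γ₁ ξ) / q.2 +
      ((∫ ξ in (0:ℝ)..(q.1.2 + q.2 * b), γ₂ ξ) - ∫ ξ in (0:ℝ)..q.1.2, γ₂ ξ) / q.2 := by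
    intro q
    simp only [hφ, Prod.fst_add, Prod.snd_add, Prod.smul_fst, Prod.smul_snd, smul_eq_mul]
    ring
  have hev : ∀ ε : ℝ, 0 < ε → ∀ᶠ q : (ℝ × ℝ) × ℝ in 𝓝 (t, s) ×ˢ 𝓝[>] 0,
      ∃ c₁ ∈ Icc (min p₁ m₁ - ε) (max p₁ m₁ + ε), ∃ c₂ ∈ Icc (min p₂ m₂ - ε) (max p₂ m₂ + ε),
        (φ (q.1 + q.2 • (a, b)) - φ q.1) / q.2 = a * c₁ + b * c₂ := by
    intro ε hε
    have hfst : Tendsto (fun q : (ℝ × ℝ) × ℝ => (q.1.1, q.2)) (𝓝 (t, s) ×ˢ 𝓝[>] 0)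
        (𝓝 t ×ˢ 𝓝[>] 0) :=
      ((continuous_fst.tendsto (t, s)).comp tendsto_fst).prodMk tendsto_snd
    have hsnd : Tendsto (fun q : (ℝ × ℝ) × ℝ => (q.1.2, q.2)) (𝓝 (t, s) ×ˢ 𝓝[>] 0)
        (𝓝 s ×ˢ 𝓝[>] 0) :=
      ((continuous_snd.tendsto (t, s)).comp tendsto_fst).prodMk tendsto_snd
    filter_upwards [hfst.eventually (eventually_quotient_eq_mul hi₁ hp₁ hm₁ a hε),
      hsnd.eventually (eventually_quotient_eq_mul hi₂ hp₂ hm₂ b hε)]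
      with q ⟨c₁, hc₁, h₁⟩ ⟨c₂, hc₂, h₂⟩
    exact ⟨c₁, hc₁, c₂, hc₂, by rw [hquot, h₁, h₂]⟩
  have hle : ∀ ε : ℝ, 0 < ε → ∀ᶠ q : (ℝ × ℝ) × ℝ in 𝓝 (t, s) ×ˢ 𝓝[>] 0,
      (φ (q.1 + q.2 • (a, b)) - φ q.1) / q.2 ≤
        max (a * p₁) (a * m₁) + max (b * p₂) (b * m₂) + (|a| + |b|) * ε := by
    intro ε hε
    filter_upwards [hev ε hε] with q ⟨c₁, hc₁, c₂, hc₂, h⟩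
    rw [h]
    linarith [mul_le_max_mul_add (a := a) hc₁, mul_le_max_mul_add (a := b) hc₂]
  have hge : ∀ᶠ q : (ℝ × ℝ) × ℝ in 𝓝 (t, s) ×ˢ 𝓝[>] 0,
      -(max (-a * p₁) (-a * m₁) + |a| + (max (-b * p₂) (-b * m₂) + |b|)) ≤
        (φ (q.1 + q.2 • (a, b)) - φ q.1) / q.2 := by
    filter_upwards [hev 1 one_pos] with q ⟨c₁, hc₁, c₂, hc₂, h⟩
    rw [h]
    have h₁ := mul_le_max_mul_add (a := -a) hc₁
    have h₂ := mul_le_max_mul_add (a := -b) hc₂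
    rw [abs_neg] at h₁ h₂
    linarith
  apply le_antisymm
  · refine le_of_forall_pos_le_add fun η hη => ?_
    have hpos : 0 < |a| + |b| + 1 := by positivity
    refine limsup_le_of_le (IsBoundedUnder.isCoboundedUnder_le ⟨_, eventually_map.2 hge⟩)
      ((hle (η / (|a| + |b| + 1)) (by positivity)).mono fun q hq => hq.trans ?_)
    have : (|a| + |b|) * (η / (|a| + |b| + 1)) ≤ (|a| + |b| + 1) * (η / (|a| + |b| + 1)) :=
      mul_le_mul_of_nonneg_right (by linarith) (by positivity)
    rw [mul_div_cancel₀ _ hpos.ne'] at this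
    linarith
  · refine le_of_forall_pos_sub_le fun η hη => ?_
    obtain ⟨w₁, hw₁, hq₁⟩ := exists_tendsto_quotient hi₁ hp₁ hm₁ a
    obtain ⟨w₂, hw₂, hq₂⟩ := exists_tendsto_quotient hi₂ hp₂ hm₂ b
    have hw : Tendsto (fun r : ℝ => ((w₁ r, w₂ r), r)) (𝓝[>] 0) (𝓝 (t, s) ×ˢ 𝓝[>] 0) :=
      (hw₁.prodMk_nhds hw₂).prodMk tendsto_id
    have hev' := (hq₁.add hq₂).eventually
      (eventually_gt_nhds (sub_lt_self (max (a * p₁) (a * m₁) + max (b * p₂) (b * m₂)) hη))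
    refine le_limsup_of_frequently_le (hw.frequently (Eventually.frequently ?_))
      ⟨_, eventually_map.2 (hle 1 one_pos)⟩
    filter_upwards [hev'] with r hr
    exact hr.le.trans (hquot ((w₁ r, w₂ r), r)).ge

/-- Chang's type Lemma: for `γ₁, γ₂ ∈ L^∞_loc(ℝ)` with
`φ(t,s) = ∫₀ᵗ γ₁ + ∫₀ˢ γ₂`, if the one-sided limits `γₖ(r±0)` exist for every `r ∈ ℝ`
(`k = 1,2`), then `∂φ(t,s) = [γ̲₁(t), γ̄₁(t)] × [γ̲₂(s), γ̄₂(s)]` (identifying `z ∈ (ℝ²)*`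
with `(z(1,0), z(0,1))`), where moreover `γ̲ₖ(r) = min{γₖ(r+0), γₖ(r−0)}` and
`γ̄ₖ(r) = max{γₖ(r+0), γₖ(r−0)}`. -/
theorem stmt10 (γ₁ γ₂ : ℝ → ℝ) (hm₁ : Measurable γ₁) (hm₂ : Measurable γ₂)
    (hloc₁ : ∀ R : ℝ, 0 < R →
      ∃ C : ℝ, ∀ᵐ s ∂(volume.restrict (Set.Icc (-R) R)), |γ₁ s| ≤ C)
    (hloc₂ : ∀ R : ℝ, 0 < R →
      ∃ C : ℝ, ∀ᵐ s ∂(volume.restrict (Set.Icc (-R) R)), |γ₂ s| ≤ C)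
    (φ : ℝ × ℝ → ℝ)
    (hφ : ∀ p : ℝ × ℝ, φ p = (∫ ξ in (0:ℝ)..p.1, γ₁ ξ) + ∫ ξ in (0:ℝ)..p.2, γ₂ ξ)
    (γ₁p γ₁m γ₂p γ₂m : ℝ → ℝ)
    (h₁p : ∀ r : ℝ, hasRightLimAe γ₁ r (γ₁p r)) (h₁m : ∀ r : ℝ, hasLeftLimAe γ₁ r (γ₁m r))
    (h₂p : ∀ r : ℝ, hasRightLimAe γ₂ r (γ₂p r)) (h₂m : ∀ r : ℝ, hasLeftLimAe γ₂ r (γ₂m r)) :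
    ∀ t s : ℝ,
      (clarkeSubdiff φ (t, s) =
        {z : (ℝ × ℝ) →L[ℝ] ℝ |
          z (1, 0) ∈ Set.Icc (gammaLower γ₁ t) (gammaUpper γ₁ t) ∧
          z (0, 1) ∈ Set.Icc (gammaLower γ₂ s) (gammaUpper γ₂ s)}) ∧
      gammaLower γ₁ t = min (γ₁p t) (γ₁m t) ∧ gammaUpper γ₁ t = max (γ₁p t) (γ₁m t) ∧
      gammaLower γ₂ s = min (γ₂p s) (γ₂m s) ∧ gammaUpper γ₂ s = max (γ₂p s) (γ₂m s) := by
  intro t s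
  have hi₁ := intervalIntegrable_of_locally_ae_bounded hm₁ hloc₁
  have hi₂ := intervalIntegrable_of_locally_ae_bounded hm₂ hloc₂
  have hU₁ := gammaUpper_eq_max hloc₁ (h₁p t) (h₁m t)
  have hU₂ := gammaUpper_eq_max hloc₂ (h₂p s) (h₂m s)
  have hL₁ := gammaLower_eq_min hloc₁ (h₁p t) (h₁m t)
  have hL₂ := gammaLower_eq_min hloc₂ (h₂p s) (h₂m s)
  have hD := clarkeDeriv_separated_integrals hi₁ hi₂ hφ (h₁p t) (h₁m t) (h₂p s) (h₂m s)
  refine ⟨?_, hL₁, hU₁, hL₂, hU₂⟩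
  rw [hU₁, hU₂, hL₁, hL₂]
  ext z
  have hz : ∀ a b : ℝ, z (a, b) = a * z (1, 0) + b * z (0, 1) := fun a b => by
    have hab : ((a, b) : ℝ × ℝ) = a • (1, 0) + b • (0, 1) := by simp
    rw [hab, map_add, map_smul, map_smul, smul_eq_mul, smul_eq_mul]
  constructor
  · intro h
    have hle : ∀ a b : ℝ, a * z (1, 0) + b * z (0, 1) ≤
        max (a * γ₁p t) (a * γ₁m t) + max (b * γ₂p s) (b * γ₂m s) := fun a b => by
      rw [← hz, ← hD]
      exact h (a, b)
    have h₁ := hle 1 0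
    have h₂ := hle (-1) 0
    have h₃ := hle 0 1
    have h₄ := hle 0 (-1)
    simp only [one_mul, zero_mul, add_zero, zero_add, max_self, neg_mul, max_neg_neg,
      neg_le_neg_iff] at h₁ h₂ h₃ h₄
    exact ⟨⟨h₂, h₁⟩, ⟨h₄, h₃⟩⟩
  · rintro ⟨h₁, h₂⟩ ⟨a, b⟩
    rw [hz, hD]
    exact add_le_add (mul_le_max_mul_of_mem_Icc h₁) (mul_le_max_mul_of_mem_Icc h₂)
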